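/- arXiv:2401.17952 — 7 statements merged into one kernel-verified Lean document; each statement's English description precedes it below -/
import Mathlib

section
/- Let X⁻ and X⁺ be as in the context, with (w,b) strictly separating (X⁺,X⁻) and the associated (d+1)×(d+1) matrix invertible. Then a point x ∈ X⁻ is a critical point if and only if P(x) is an extreme point of the convex hull of P(X⁺ ∪ X⁻); equivalently, the set of critical points equals {x ∈ X⁻ : P(x) ∉ convexHull(P(X⁺ ∪ X⁻) \ {P(x)})}. -/
/-- a point x ∈ X⁻ is a critical point (some (u,c) strictly separates
(X⁺ ∪ {x}, X⁻ \ {x})) if and only if P(x) is not in the convex hull of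
P(X⁺ ∪ X⁻) \ {P(x)}, assuming (w,b) strictly separates (X⁺, X⁻) and the associated
(d+1)×(d+1) matrix is invertible. -/
theorem stmt_0 (d : ℕ) (hd : 1 ≤ d)
    (w : Fin d → ℝ) (b : ℝ) (a : Fin d → ℝ) (v : Fin d → Fin d → ℝ)
    (g : (Fin d → ℝ) → ℝ) (hg : ∀ x, g x = b + ∑ i, w i * x i)
    (P : (Fin d → ℝ) → (Fin d → ℝ))
    (hP : ∀ x, g x ≠ 0 → ∀ j, P x j = (a j + ∑ i, v j i * x i) / g x)
    (M : Matrix (Fin (d + 1)) (Fin (d + 1)) ℝ)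
    (hM : ∀ i j, M i j =
      Fin.cases (Fin.cases b (fun i' => w i') i)
        (fun j' => Fin.cases (a j') (fun i' => v j' i') i) j)
    (hMinv : IsUnit M)
    (Xp Xm : Finset (Fin d → ℝ)) (hdisj : Disjoint Xp Xm)
    (hsep_pos : ∀ x ∈ Xp, 0 < g x)
    (hsep_neg : ∀ x ∈ Xm, g x < 0) :
    ∀ x ∈ Xm,
      ((∃ (u : Fin d → ℝ) (c : ℝ),
          (∀ y ∈ (↑Xp : Set (Fin d → ℝ)) ∪ {x}, 0 < (∑ i, u i * y i) + c) ∧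
          (∀ y ∈ (↑Xm : Set (Fin d → ℝ)) \ {x}, (∑ i, u i * y i) + c < 0)) ↔
        P x ∉ convexHull ℝ ((P '' ((↑Xp : Set (Fin d → ℝ)) ∪ ↑Xm)) \ {P x})) := by
  have fwd : ∀ (q : Fin d → ℝ) (γ : ℝ) (y : Fin d → ℝ), g y ≠ 0 →
      (∑ i, (γ * w i + ∑ j, q j * v j i) * y i) + (γ * b + ∑ j, q j * a j)
        = g y * (γ + ∑ j, q j * P y j) := by
    intro q γ y hy
    have h1 : ∀ j, g y * (q j * P y j) = q j * a j + ∑ i, q j * v j i * y i := by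
      intro j
      rw [hP y hy j]
      have : g y * (q j * ((a j + ∑ i, v j i * y i) / g y))
          = q j * (a j + ∑ i, v j i * y i) := by field_simp
      rw [this, mul_add, Finset.mul_sum]
      simp only [mul_assoc]
    rw [mul_add, Finset.mul_sum, Finset.sum_congr rfl (fun j _ => h1 j),
      Finset.sum_add_distrib, Finset.sum_comm, hg y, add_mul, Finset.sum_mul]
    simp only [add_mul, Finset.sum_add_distrib, Finset.sum_mul]
    have h2 : ∑ i, γ * w i * y i = ∑ i, w i * y i * γ :=
      Finset.sum_congr rfl (fun i _ => by ring)
    rw [h2]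
    ring
  have surj : ∀ (u : Fin d → ℝ) (c : ℝ), ∃ (q : Fin d → ℝ) (γ : ℝ),
      ∀ y, g y ≠ 0 → (∑ i, u i * y i) + c = g y * (γ + ∑ j, q j * P y j) := by
    intro u c
    obtain ⟨z, hz⟩ := (Matrix.mulVec_surjective_iff_isUnit.mpr hMinv)
      (Fin.cons c u : Fin (d + 1) → ℝ)
    refine ⟨fun j => z j.succ, z 0, fun y hy => ?_⟩
    rw [← fwd _ _ y hy]
    have h0 := congrFun hz 0
    have hs := fun i : Fin d => congrFun hz i.succ
    simp only [Matrix.mulVec, dotProduct, Fin.sum_univ_succ, hM, Fin.cases_zero,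
      Fin.cases_succ, Fin.cons_zero, Fin.cons_succ] at h0 hs
    rw [← h0]
    congr 1
    · refine Finset.sum_congr rfl (fun i _ => ?_)
      rw [← hs i]
      simp only [mul_comm]
    · simp only [mul_comm]
  have inj : ∀ x y, g x ≠ 0 → g y ≠ 0 → P x = P y → x = y := by
    intro x y hx hy hxy
    have hgg : g x = g y := by
      obtain ⟨q, γ, h⟩ := surj 0 1
      have e1 := h x hx
      have e2 := h y hy
      rw [hxy] at e1
      simp only [Pi.zero_apply, zero_mul, Finset.sum_const_zero, zero_add] at e1 e2
      have : γ + ∑ j, q j * P y j ≠ 0 := by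
        intro h0
        rw [h0] at e1
        simp at e1
      exact mul_right_cancel₀ this (e1.symm.trans e2)
    funext i
    obtain ⟨q, γ, h⟩ := surj (Pi.single i 1) 0
    have e1 := h x hx
    have e2 := h y hy
    rw [hxy, hgg, ← e2] at e1
    simpa [Pi.single_apply] using e1
  intro x hx
  have hgx := hsep_neg x hx
  constructor
  · rintro ⟨u, c, h1, h2⟩ hmem
    obtain ⟨q, γ, h⟩ := surj u c
    have hconv : Convex ℝ {z : Fin d → ℝ | -γ < ∑ j, q j * z j} := by
      refine convex_halfSpace_gt ⟨fun x y => ?_, fun r x => ?_⟩ _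
      · simp [mul_add, Finset.sum_add_distrib]
      · simp [Finset.mul_sum, mul_left_comm]
    have hsub : (P '' ((↑Xp : Set (Fin d → ℝ)) ∪ ↑Xm)) \ {P x} ⊆
        {z : Fin d → ℝ | -γ < ∑ j, q j * z j} := by
      rintro _ ⟨⟨y, hy, rfl⟩, hne⟩
      have hyx : y ≠ x := fun e => hne (by simp [e])
      simp only [Set.mem_setOf_eq]
      rcases hy with hy | hy
      · have hp := hsep_pos y hy
        have := h1 y (Or.inl hy)
        rw [h y hp.ne'] at this
        have := (mul_pos_iff_of_pos_left hp).1 this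
        linarith
      · have hp := hsep_neg y hy
        have := h2 y ⟨hy, hyx⟩
        rw [h y hp.ne] at this
        by_contra hc
        nlinarith
    have := convexHull_min hsub hconv hmem
    simp only [Set.mem_setOf_eq] at this
    have h3 := h1 x (Or.inr rfl)
    rw [h x hgx.ne] at h3
    nlinarith
  · intro hn
    have hfin : ((P '' ((↑Xp : Set (Fin d → ℝ)) ∪ ↑Xm)) \ {P x}).Finite :=
      ((Xp.finite_toSet.union Xm.finite_toSet).image P).subset Set.diff_subset
    obtain ⟨f, s, hfs, hf⟩ := geometric_hahn_banach_point_closed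
      (convex_convexHull ℝ _) (hfin.isClosed_convexHull (𝕜 := ℝ)) hn
    have hfe : ∀ z : Fin d → ℝ, f z = ∑ j, f (Pi.single j 1) * z j := by
      intro z
      conv_lhs => rw [pi_eq_sum_univ' z]
      rw [map_sum]
      refine Finset.sum_congr rfl (fun j _ => ?_)
      rw [map_smul, smul_eq_mul, mul_comm]
    have key := fwd (fun j => f (Pi.single j 1)) (-s)
    simp only [← hfe] at key
    refine ⟨fun i => -s * w i + f fun j => v j i, -s * b + f a, fun y hy => ?_, fun y hy => ?_⟩
    · rcases hy with hy | hy
      · have hp := hsep_pos y hy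
        rw [key y hp.ne']
        have hyx : P y ≠ P x := fun e => by
          have := inj y x hp.ne' hgx.ne e
          subst this
          linarith
        have := hf (P y) (subset_convexHull ℝ _ ⟨⟨y, Or.inl hy, rfl⟩, hyx⟩)
        exact mul_pos hp (by linarith)
      · rw [Set.mem_singleton_iff] at hy
        subst hy
        rw [key _ hgx.ne]
        exact mul_pos_of_neg_of_neg hgx (by linarith)
    · have hp := hsep_neg y hy.1
      rw [key y hp.ne]
      have hyx : P y ≠ P x := fun e => hy.2 (inj y x hp.ne hgx.ne e)
      have := hf (P y) (subset_convexHull ℝ _ ⟨⟨y, Or.inr hy.1, rfl⟩, hyx⟩)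
      exact mul_neg_of_neg_of_pos hp (by linarith)
end

section
/- Let S ⊆ {1,…,N} be arbitrary and let M be any function assigning to each labeling g : {1,…,N} → {−1,+1} a subset M(g) ⊆ {1,…,N}, with the property that M(g) = M(g′) whenever g and g′ agree on S (the output depends only on the labels of points in S). If {i : f_j(i) = +1} ⊆ M(f_j) for every j ∈ {1,…,L} (perfect recall on every instance of the family), then there exists j ∈ {1,…,L} such that |(S ∪ M(f_j)) ∩ {i : f_j(i) = −1}| ≥ L − 1; that is, on some instance the total number of non-responsive points that are queried or output is at least log₂(N) − 1. -/
/-- bucket lower bound.  Buckets B₀ = {1}, B_j = (2^{j−1}, 2^j] partition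
{1,…,N}, N = 2^L; f_j labels B₀ ∪ B_j positive.  If M depends only on labels on S and
has perfect recall on every instance f_j, then on some instance the number of negative
points in S ∪ M(f_j) is at least L − 1. -/
theorem stmt_6 (L : ℕ) (hL : 2 ≤ L) (N : ℕ) (hN : N = 2 ^ L)
    (f : ℕ → ℕ → ℤ)
    (hf : ∀ j i, f j i = if i = 1 ∨ (2 ^ (j - 1) < i ∧ i ≤ 2 ^ j) then 1 else -1)
    (S : Finset ℕ) (hS : S ⊆ Finset.Icc 1 N)
    (M : (ℕ → ℤ) → Finset ℕ)
    (hMsub : ∀ g, M g ⊆ Finset.Icc 1 N)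
    (hMdep : ∀ g g', (∀ i ∈ S, g i = g' i) → M g = M g')
    (hrecall : ∀ j ∈ Finset.Icc 1 L, ∀ i ∈ Finset.Icc 1 N, f j i = 1 → i ∈ M (f j)) :
    ∃ j ∈ Finset.Icc 1 L,
      L - 1 ≤ ((S ∪ M (f j)).filter (fun i => f j i = -1)).card := by
  have disj : ∀ j k i : ℕ, 1 ≤ j → 1 ≤ k → (2 ^ (j - 1) < i ∧ i ≤ 2 ^ j) →
      (2 ^ (k - 1) < i ∧ i ≤ 2 ^ k) → j = k := by
    intro j k i hj hk h1 h2
    have a : 2 ^ (j - 1) < 2 ^ k := lt_of_lt_of_le h1.1 h2.2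
    have b : 2 ^ (k - 1) < 2 ^ j := lt_of_lt_of_le h2.1 h1.2
    have a' := (Nat.pow_lt_pow_iff_right (by norm_num : 1 < 2)).1 a
    have b' := (Nat.pow_lt_pow_iff_right (by norm_num : 1 < 2)).1 b
    omega
  have key : ∃ j ∈ Finset.Icc 1 L, ∀ k ∈ (Finset.Icc 1 L).erase j,
      ∃ i ∈ S ∪ M (f j), 2 ^ (k - 1) < i ∧ i ≤ 2 ^ k := by
    by_cases hT : ∃ j ∈ Finset.Icc 1 L, ∀ i ∈ S, ¬ (2 ^ (j - 1) < i ∧ i ≤ 2 ^ j)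
    · obtain ⟨j, hj, hjS⟩ := hT
      refine ⟨j, hj, fun k hk => ?_⟩
      have hk' := Finset.mem_of_mem_erase hk
      by_cases hkS : ∃ i ∈ S, 2 ^ (k - 1) < i ∧ i ≤ 2 ^ k
      · obtain ⟨i, hi, h⟩ := hkS
        exact ⟨i, Finset.mem_union_left _ hi, h⟩
      · have hM : M (f j) = M (f k) := by
          apply hMdep
          intro i hi
          have h1 := hjS i hi
          have h2 : ¬ (2 ^ (k - 1) < i ∧ i ≤ 2 ^ k) := fun h => hkS ⟨i, hi, h⟩
          simp only [hf, h1, h2]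
        have hk1 := Finset.mem_Icc.1 hk'
        have hlt : 2 ^ (k - 1) < 2 ^ k :=
          Nat.pow_lt_pow_right (by norm_num) (by omega)
        refine ⟨2 ^ k, Finset.mem_union_right _ ?_, hlt, le_rfl⟩
        rw [hM]
        apply hrecall k hk'
        · rw [Finset.mem_Icc, hN]
          exact ⟨Nat.one_le_two_pow, Nat.pow_le_pow_right (by norm_num) hk1.2⟩
        · rw [hf, if_pos (Or.inr ⟨hlt, le_rfl⟩)]
    · push Not at hT
      refine ⟨1, Finset.mem_Icc.2 ⟨le_rfl, by omega⟩, fun k hk => ?_⟩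
      obtain ⟨i, hi, h⟩ := hT k (Finset.mem_of_mem_erase hk)
      exact ⟨i, Finset.mem_union_left _ hi, h⟩
  obtain ⟨j, hj, hkey⟩ := key
  refine ⟨j, hj, ?_⟩
  choose! p hp using hkey
  have hcard : ((Finset.Icc 1 L).erase j).card = L - 1 := by
    rw [Finset.card_erase_of_mem hj]; simp
  rw [← hcard]
  have hj1 := (Finset.mem_Icc.1 hj).1
  apply Finset.card_le_card_of_injOn p
  · intro k hk
    have hk0 := Finset.mem_coe.1 hk
    obtain ⟨hm, hb⟩ := hp k hk0
    have hk1 := (Finset.mem_Icc.1 (Finset.mem_of_mem_erase hk0)).1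
    refine Finset.mem_coe.2 (Finset.mem_filter.2 ⟨hm, ?_⟩)
    rw [hf, if_neg]
    rintro (h | h)
    · have : 1 ≤ 2 ^ (k - 1) := Nat.one_le_two_pow
      omega
    · exact Finset.ne_of_mem_erase hk0 (disj k j _ hk1 hj1 hb h)
  · intro k hk l hl hkl
    have hk0 := Finset.mem_coe.1 hk
    have hl0 := Finset.mem_coe.1 hl
    have hk1 := (Finset.mem_Icc.1 (Finset.mem_of_mem_erase hk0)).1
    have hl1 := (Finset.mem_Icc.1 (Finset.mem_of_mem_erase hl0)).1
    have h2 := (hp l hl0).2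
    rw [← hkl] at h2
    exact disj k l _ hk1 hl1 (hp k hk0).2 h2
end

section
/- Let L ≥ 2, N = 2^L, let x₁ > x₂ > ⋯ > x_N be distinct reals, R = {x₁,…,x_N}, and for j ∈ {2,…,L} define the labels f_j(x_i) = +1 if i = 1 or 2^{j−1} < i ≤ 2^j, and f_j(x_i) = −1 otherwise. Then for each j ∈ {2,…,L}, the minimum of err over t ∈ T equals 2^{j−1} − 1; it is attained at t = x_{2^j}; and the threshold x_{2^j} has no false negatives, i.e., every x_i with f_j(x_i) = +1 satisfies x_i ≥ x_{2^j} (so the optimal classifier has recall 1 on this instance). -/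
/-- The error of the threshold classifier at `t` on the instance `(R, f)`:
points `x ≥ t` are predicted `+1`, points `x < t` are predicted `-1`. -/
noncomputable def errOf (R : Finset ℝ) (f : ℝ → ℤ) (t : ℝ) : ℕ :=
  (R.filter (fun x => t ≤ x ∧ f x = -1)).card +
    (R.filter (fun x => x < t ∧ f x = 1)).card

/-- for the bucket instances on x₁ > ⋯ > x_N (N = 2^L), for each
j ∈ {2,…,L} the minimum threshold error is 2^{j−1} − 1, attained at t = x_{2^j},
and the threshold x_{2^j} has no false negatives. -/
theorem stmt_7 (L : ℕ) (hL : 2 ≤ L) (N : ℕ) (hN : N = 2 ^ L)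
    (x : ℕ → ℝ)
    (hx : ∀ i j, 1 ≤ i → i < j → j ≤ N → x j < x i)
    (R : Finset ℝ) (hR : R = (Finset.Icc 1 N).image x)
    (t₀ : ℝ) (ht₀ : ∀ y ∈ R, y < t₀)
    (f : ℕ → ℝ → ℤ)
    (hf : ∀ j, ∀ i ∈ Finset.Icc 1 N,
      f j (x i) = if i = 1 ∨ (2 ^ (j - 1) < i ∧ i ≤ 2 ^ j) then 1 else -1) :
    ∀ j ∈ Finset.Icc 2 L,
      errOf R (f j) (x (2 ^ j)) = 2 ^ (j - 1) - 1 ∧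
      (∀ t ∈ insert t₀ R, 2 ^ (j - 1) - 1 ≤ errOf R (f j) t) ∧
      (∀ i ∈ Finset.Icc 1 N, f j (x i) = 1 → x (2 ^ j) ≤ x i) := by
  intro j hj
  rw [Finset.mem_Icc] at hj
  obtain ⟨hj2, hjL⟩ := hj
  have hM2 : 2 ^ j = 2 * 2 ^ (j - 1) := by
    rw [← pow_succ']; congr 1; omega
  have hM : 2 ≤ 2 ^ (j - 1) := by
    calc 2 = 2 ^ 1 := by norm_num
      _ ≤ 2 ^ (j - 1) := Nat.pow_le_pow_right (by norm_num) (by omega)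
  have hMN : 2 ^ j ≤ N := by
    rw [hN]; exact Nat.pow_le_pow_right (by norm_num) hjL
  have hfj := hf j
  rw [hM2] at hMN hfj ⊢
  generalize 2 ^ (j - 1) = M at *
  have hinj : Set.InjOn x (Finset.Icc 1 N : Finset ℕ) := by
    intro a ha b hb hab
    simp only [Finset.coe_Icc, Set.mem_Icc] at ha hb
    rcases lt_trichotomy a b with h | h | h
    · exact absurd hab (hx a b ha.1 h hb.2).ne'
    · exact h
    · exact absurd hab (hx b a hb.1 h ha.2).ne
  have key : ∀ t k, (∀ i ∈ Finset.Icc 1 N, (t ≤ x i ↔ i ≤ k)) →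
      errOf R (f j) t =
        ((Finset.Icc 1 N).filter (fun i => i ≤ k ∧ ¬ (i = 1 ∨ (M < i ∧ i ≤ 2 * M)))).card +
        ((Finset.Icc 1 N).filter (fun i => k < i ∧ (i = 1 ∨ (M < i ∧ i ≤ 2 * M)))).card := by
    intro t k h
    unfold errOf
    rw [hR, Finset.filter_image, Finset.filter_image,
      Finset.card_image_of_injOn (hinj.mono (Finset.coe_subset.mpr (Finset.filter_subset _ _))),
      Finset.card_image_of_injOn (hinj.mono (Finset.coe_subset.mpr (Finset.filter_subset _ _)))]
    congr 2
    · apply Finset.filter_congr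
      intro i hi
      rw [h i hi, hfj i hi]
      split_ifs with hc <;> simp [hc]
    · apply Finset.filter_congr
      intro i hi
      rw [← not_le, h i hi, hfj i hi]
      split_ifs with hc <;> simp [hc]
  have hk : ∀ k ∈ Finset.Icc 1 N, ∀ i ∈ Finset.Icc 1 N, (x k ≤ x i ↔ i ≤ k) := by
    intro k hk i hi
    rw [Finset.mem_Icc] at hk hi
    constructor
    · intro h
      by_contra hc
      exact absurd (hx k i hk.1 (by omega) hi.2) (not_lt.mpr h)
    · intro h
      rcases h.eq_or_lt with h | h
      · rw [h]
      · exact (hx i k hi.1 h hk.2).le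
  have lower : ∀ t k, (∀ i ∈ Finset.Icc 1 N, (t ≤ x i ↔ i ≤ k)) → M - 1 ≤ errOf R (f j) t := by
    intro t k h
    rw [key t k h]
    rcases le_total k M with hkM | hkM
    · have : (Finset.Ioc M (2 * M)).card ≤ _ := Finset.card_le_card
        (t := (Finset.Icc 1 N).filter (fun i => k < i ∧ (i = 1 ∨ (M < i ∧ i ≤ 2 * M)))) (by
          intro i hi
          simp only [Finset.mem_Ioc, Finset.mem_filter, Finset.mem_Icc] at hi ⊢
          omega)
      rw [Nat.card_Ioc] at this
      omega
    · have : (Finset.Icc 2 M).card ≤ _ := Finset.card_le_card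
        (t := (Finset.Icc 1 N).filter (fun i => i ≤ k ∧ ¬ (i = 1 ∨ (M < i ∧ i ≤ 2 * M)))) (by
          intro i hi
          simp only [Finset.mem_filter, Finset.mem_Icc] at hi ⊢
          omega)
      rw [Nat.card_Icc] at this
      omega
  have h2M : 2 * M ∈ Finset.Icc 1 N := by rw [Finset.mem_Icc]; omega
  refine ⟨?_, ?_, ?_⟩
  · rw [key _ _ (hk _ h2M)]
    have e1 : (Finset.Icc 1 N).filter
        (fun i => i ≤ 2 * M ∧ ¬ (i = 1 ∨ (M < i ∧ i ≤ 2 * M))) = Finset.Icc 2 M := by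
      ext i
      simp only [Finset.mem_filter, Finset.mem_Icc]
      omega
    have e2 : (Finset.Icc 1 N).filter
        (fun i => 2 * M < i ∧ (i = 1 ∨ (M < i ∧ i ≤ 2 * M))) = ∅ := by
      ext i
      simp only [Finset.mem_filter, Finset.mem_Icc, Finset.notMem_empty, iff_false]
      omega
    rw [e1, e2, Nat.card_Icc, Finset.card_empty]
    omega
  · intro t ht
    rw [Finset.mem_insert] at ht
    rcases ht with rfl | ht
    · apply lower t 0
      intro i hi
      have h1 := ht₀ (x i) (by rw [hR]; exact Finset.mem_image_of_mem x hi)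
      rw [Finset.mem_Icc] at hi
      constructor
      · intro h; exact absurd h1 (not_lt.mpr h)
      · intro h; omega
    · rw [hR, Finset.mem_image] at ht
      obtain ⟨k, hk1, rfl⟩ := ht
      exact lower _ k (hk k hk1)
  · intro i hi h
    rw [hfj i hi] at h
    rw [hk _ h2M i hi]
    split_ifs at h with hc
    · omega
end

section
/- If the report f_A hides no negatives, then for all real numbers s ≤ t one has err_A(s) − err_A(t) ≥ err(s) − err(t). -/
/-- If the report f_A hides no negatives, then for all real numbers
s ≤ t one has err_A(s) − err_A(t) ≥ err(s) − err(t). -/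
theorem stmt_9 (R : Finset ℝ) (hR : R.Nonempty) (f fA : ℝ → ℤ)
    (hf : ∀ x ∈ R, f x = 1 ∨ f x = -1)
    (hfA : ∀ x ∈ R, fA x = 1 ∨ fA x = -1)
    (hhide : ∀ x ∈ R, fA x = 1 → f x = 1)
    (s t : ℝ) (hst : s ≤ t) :
    (errOf R f s : ℤ) - (errOf R f t : ℤ) ≤
      (errOf R fA s : ℤ) - (errOf R fA t : ℤ) := by
  unfold errOf
  simp only [Finset.card_filter]
  push_cast
  simp only [← Finset.sum_add_distrib, ← Finset.sum_sub_distrib]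
  apply Finset.sum_le_sum
  intro x hx
  have h3 := hhide x hx
  rcases lt_or_ge x s with h | h
  · have h' : x < t := lt_of_lt_of_le h hst
    simp [h, h', not_le.mpr h, not_le.mpr h']
  · rcases lt_or_ge x t with h' | h'
    · rcases hf x hx with h1 | h1 <;> rcases hfA x hx with h2 | h2 <;>
        simp_all [not_lt.mpr h, not_le.mpr h']
    · simp [h, h', not_lt.mpr h, not_lt.mpr h']
end

section
/- Assume the report f_A hides no negatives, let k ≥ 1 be an integer, and suppose err(t*_A) ≥ err(t*) + k. Set a = |{x ∈ R : t* ≤ x < t*_A, f(x) = +1 and f_A(x) = −1}|, a′ = |{x ∈ R : t* ≤ x < t*_A, f(x) = +1}|, and b = |{x ∈ R : t* ≤ x < t*_A, f(x) = −1}|. Then: (i) a′ − b ≥ k; (ii) 2a ≥ a′ − b, and in particular 2a ≥ k; (iii) a′ − a ≤ err_A(t*_A); and (iv) a·(2 + 2·err_A(t*_A)/k) ≥ a + b. -/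
theorem errOf_shift (R : Finset ℝ) (f : ℝ → ℤ) (s t : ℝ) (h : s ≤ t) :
    errOf R f t + (R.filter (fun x => s ≤ x ∧ x < t ∧ f x = -1)).card =
      errOf R f s + (R.filter (fun x => s ≤ x ∧ x < t ∧ f x = 1)).card := by
  unfold errOf
  have h1 : (R.filter (fun x => s ≤ x ∧ f x = -1)).card =
      (R.filter (fun x => t ≤ x ∧ f x = -1)).card +
      (R.filter (fun x => s ≤ x ∧ x < t ∧ f x = -1)).card := by
    rw [← Finset.card_union_of_disjoint]
    · congr 1
      ext x
      simp only [Finset.mem_filter, Finset.mem_union]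
      grind
    · rw [Finset.disjoint_left]
      intro x
      simp only [Finset.mem_filter]
      grind
  have h2 : (R.filter (fun x => x < t ∧ f x = 1)).card =
      (R.filter (fun x => x < s ∧ f x = 1)).card +
      (R.filter (fun x => s ≤ x ∧ x < t ∧ f x = 1)).card := by
    rw [← Finset.card_union_of_disjoint]
    · congr 1
      ext x
      simp only [Finset.mem_filter, Finset.mem_union]
      grind
    · rw [Finset.disjoint_left]
      intro x
      simp only [Finset.mem_filter]
      grind
  omega

/-- Assume the report f_A hides no negatives, k ≥ 1 an integer,
err(t*_A) ≥ err(t*) + k.  With a = #(hidden positives in [t*, t*_A)),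
a′ = #(positives in [t*, t*_A)), b = #(negatives in [t*, t*_A)):
(i) a′ − b ≥ k; (ii) 2a ≥ a′ − b and 2a ≥ k; (iii) a′ − a ≤ err_A(t*_A);
(iv) a·(2 + 2·err_A(t*_A)/k) ≥ a + b. -/
theorem stmt_11 (R : Finset ℝ) (hR : R.Nonempty) (f fA : ℝ → ℤ)
    (hf : ∀ x ∈ R, f x = 1 ∨ f x = -1)
    (hfA : ∀ x ∈ R, fA x = 1 ∨ fA x = -1)
    (t₀ : ℝ) (ht₀ : ∀ x ∈ R, x < t₀)
    (tstar : ℝ) (htstar_mem : tstar ∈ insert t₀ R)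
    (htstar_min : ∀ t ∈ insert t₀ R, errOf R f tstar ≤ errOf R f t)
    (htstar_largest : ∀ t ∈ insert t₀ R, errOf R f t = errOf R f tstar → t ≤ tstar)
    (tA : ℝ) (htA_mem : tA ∈ insert t₀ R)
    (htA_min : ∀ t ∈ insert t₀ R, errOf R fA tA ≤ errOf R fA t)
    (htA_smallest : ∀ t ∈ insert t₀ R, errOf R fA t = errOf R fA tA → tA ≤ t)
    (hhide : ∀ x ∈ R, fA x = 1 → f x = 1)
    (k : ℕ) (hk : 1 ≤ k)
    (hgap : errOf R f tstar + k ≤ errOf R f tA)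
    (a a' b : ℕ)
    (ha : a = (R.filter (fun x => tstar ≤ x ∧ x < tA ∧ f x = 1 ∧ fA x = -1)).card)
    (ha' : a' = (R.filter (fun x => tstar ≤ x ∧ x < tA ∧ f x = 1)).card)
    (hb : b = (R.filter (fun x => tstar ≤ x ∧ x < tA ∧ f x = -1)).card) :
    ((b : ℤ) + k ≤ (a' : ℤ)) ∧
    ((a' : ℤ) - (b : ℤ) ≤ 2 * (a : ℤ)) ∧ (k ≤ 2 * a) ∧
    ((a' : ℤ) - (a : ℤ) ≤ (errOf R fA tA : ℤ)) ∧
    ((a : ℝ) + (b : ℝ) ≤ (a : ℝ) * (2 + 2 * (errOf R fA tA : ℝ) / (k : ℝ))) := by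
  have hle : tstar ≤ tA := by
    by_contra hlt
    have hlt : tA ≤ tstar := le_of_lt (not_le.mp hlt)
    have e1 := errOf_shift R f tA tstar hlt
    have e2 := errOf_shift R fA tA tstar hlt
    have e3 := htA_min tstar htstar_mem
    have e4 : (R.filter (fun x => tA ≤ x ∧ x < tstar ∧ fA x = 1)).card ≤
        (R.filter (fun x => tA ≤ x ∧ x < tstar ∧ f x = 1)).card := by
      apply Finset.card_le_card
      intro x
      simp only [Finset.mem_filter]
      grind
    have e5 : (R.filter (fun x => tA ≤ x ∧ x < tstar ∧ f x = -1)).card ≤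
        (R.filter (fun x => tA ≤ x ∧ x < tstar ∧ fA x = -1)).card := by
      apply Finset.card_le_card
      intro x
      simp only [Finset.mem_filter]
      grind
    omega
  have e1 := errOf_shift R f tstar tA hle
  have e2 := errOf_shift R fA tstar tA hle
  have e3 := htA_min tstar htstar_mem
  have e4 : (R.filter (fun x => tstar ≤ x ∧ x < tA ∧ fA x = -1)).card = b + a := by
    rw [hb, ha, ← Finset.card_union_of_disjoint]
    · congr 1
      ext x
      simp only [Finset.mem_filter, Finset.mem_union]
      grind
    · rw [Finset.disjoint_left]
      intro x
      simp only [Finset.mem_filter]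
      grind
  have e5 : a' = (R.filter (fun x => tstar ≤ x ∧ x < tA ∧ fA x = 1)).card + a := by
    rw [ha', ha, ← Finset.card_union_of_disjoint]
    · congr 1
      ext x
      simp only [Finset.mem_filter, Finset.mem_union]
      grind
    · rw [Finset.disjoint_left]
      intro x
      simp only [Finset.mem_filter]
      grind
  have e6 : (R.filter (fun x => tstar ≤ x ∧ x < tA ∧ fA x = 1)).card ≤ errOf R fA tA := by
    refine le_trans (Finset.card_le_card ?_) (Nat.le_add_left _ _)
    intro x
    simp only [Finset.mem_filter]
    grind
  rw [← ha', ← hb] at e1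
  have i1 : b + k ≤ a' := by omega
  have i2 : k ≤ 2 * a := by omega
  have i3 : a' ≤ errOf R fA tA + a := by omega
  refine ⟨by omega, by omega, i2, by omega, ?_⟩
  generalize errOf R fA tA = E at i3
  have hk0 : (0 : ℝ) < k := by exact_mod_cast hk
  have j1 : (b : ℝ) ≤ E + a := by exact_mod_cast (by omega : b ≤ E + a)
  have j2 : (k : ℝ) ≤ 2 * a := by exact_mod_cast i2
  have j3 : (E : ℝ) ≤ a * (2 * E / k) := by
    rw [← mul_div_assoc, le_div_iff₀ hk0]
    nlinarith [mul_le_mul_of_nonneg_left j2 (Nat.cast_nonneg (α := ℝ) E)]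
  rw [mul_add]
  linarith
end

section
/- For every real c ≥ 0, integers a ≥ 1 and b ≥ 0, and positive integers i₁ < i₂ < ⋯ < i_a satisfying i_j ≤ b + j for every j ∈ {1,…,a}, one has ∏_{j=1}^{a} (1 − min(1, c/i_j)) ≤ exp(−c·a/(a+b)). -/
/-- For every real c ≥ 0, integers a ≥ 1 and b ≥ 0, and positive
integers i₁ < i₂ < ⋯ < i_a satisfying i_j ≤ b + j for every j ∈ {1,…,a}, one has
∏_{j=1}^{a} (1 − min(1, c/i_j)) ≤ exp(−c·a/(a+b)). -/
theorem stmt_12 (c : ℝ) (hc : 0 ≤ c) (a b : ℕ) (ha : 1 ≤ a)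
    (idx : Fin a → ℕ) (hmono : StrictMono idx)
    (hpos : ∀ j, 0 < idx j)
    (hle : ∀ j : Fin a, idx j ≤ b + (j.1 + 1)) :
    ∏ j, (1 - min 1 (c / (idx j : ℝ))) ≤ Real.exp (-(c * a / ((a : ℝ) + (b : ℝ)))) := by
  have hab : (0 : ℝ) < (a : ℝ) + (b : ℝ) := by
    have : (1 : ℝ) ≤ a := by exact_mod_cast ha
    positivity
  have key : ∀ j ∈ (Finset.univ : Finset (Fin a)),
      1 - min 1 (c / (idx j : ℝ)) ≤ Real.exp (-(c / ((a : ℝ) + (b : ℝ)))) := by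
    intro j _
    rcases le_total 1 (c / (idx j : ℝ)) with h | h
    · rw [min_eq_left h, sub_self]
      exact (Real.exp_pos _).le
    · rw [min_eq_right h]
      have h1 : (0 : ℝ) < idx j := by exact_mod_cast hpos j
      have h2 : (idx j : ℝ) ≤ (a : ℝ) + (b : ℝ) := by
        have h3 := hle j
        have h4 := j.2
        have h5 : idx j ≤ a + b := by omega
        exact_mod_cast h5
      have h6 : c / ((a : ℝ) + (b : ℝ)) ≤ c / (idx j : ℝ) :=
        div_le_div_of_nonneg_left hc h1 h2
      have h7 := Real.add_one_le_exp (-(c / ((a : ℝ) + (b : ℝ))))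
      linarith
  refine (Finset.prod_le_prod (fun j _ => sub_nonneg.2 (min_le_left _ _)) key).trans ?_
  rw [Finset.prod_const, Finset.card_univ, Fintype.card_fin, ← Real.exp_nat_mul]
  apply le_of_eq
  congr 1
  ring
end

section
/- Let ε₁,…,ε_m ∈ {−1,+1} with a = |{i : ε_i = +1}| and b = |{i : ε_i = −1}|. Define breakpoints greedily: i₁ is the least index i such that |{l ≤ i : ε_l = +1}| ≥ |{l ≤ i : ε_l = −1}| (if one exists), and inductively i_{t+1} is the least index i > i_t such that |{l : i_t < l ≤ i, ε_l = +1}| ≥ |{l : i_t < l ≤ i, ε_l = −1}| (if one exists); let i₁ < ⋯ < i_q be all breakpoints so obtained, with i₀ = 0. Then: (i) for each t ∈ {1,…,q}, the block {l : i_{t−1} < l ≤ i_t} either consists of a single index carrying label +1, or contains equally many +1 labels and −1 labels; and (ii) q ≥ a − b. -/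
/-- Number of indices `l` with `s < l ≤ e` carrying label `σ` in the sequence `ε`. -/
def cnt (ε : ℕ → ℤ) (σ : ℤ) (s e : ℕ) : ℕ :=
  ((Finset.Ioc s e).filter (fun l => ε l = σ)).card

theorem cnt_self (ε : ℕ → ℤ) (σ : ℤ) (s : ℕ) : cnt ε σ s s = 0 := by
  simp [cnt]

theorem cnt_succ (ε : ℕ → ℤ) (σ : ℤ) (s e : ℕ) (h : s ≤ e) :
    cnt ε σ s (e + 1) = cnt ε σ s e + if ε (e + 1) = σ then 1 else 0 := by
  have h1 : Finset.Ioc s (e + 1) = insert (e + 1) (Finset.Ioc s e) := by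
    ext x
    simp only [Finset.mem_Ioc, Finset.mem_insert]
    omega
  unfold cnt
  rw [h1, Finset.filter_insert]
  split_ifs with hc
  · rw [Finset.card_insert_of_notMem (by simp)]
  · rfl

theorem cnt_add (ε : ℕ → ℤ) (σ : ℤ) (s e : ℕ) (h : s ≤ e) (f : ℕ) (hf : e ≤ f) :
    cnt ε σ s f = cnt ε σ s e + cnt ε σ e f := by
  induction f, hf using Nat.le_induction with
  | base => simp [cnt_self]
  | succ n hn ih =>
    rw [cnt_succ _ _ _ _ (h.trans hn), cnt_succ _ _ _ _ hn, ih, add_assoc]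

/-- greedy breakpoints i₁ < ⋯ < i_q of a ±1 label sequence.
(i) each block is either a single +1 index or balanced; (ii) q ≥ a − b. -/
theorem stmt_13 (m : ℕ) (ε : ℕ → ℤ)
    (hε : ∀ i ∈ Finset.Icc 1 m, ε i = 1 ∨ ε i = -1)
    (a b : ℕ)
    (ha : a = ((Finset.Icc 1 m).filter (fun i => ε i = 1)).card)
    (hb : b = ((Finset.Icc 1 m).filter (fun i => ε i = -1)).card)
    (q : ℕ) (idx : ℕ → ℕ)
    (hidx0 : idx 0 = 0)
    -- each breakpoint i_t is the least index after i_{t-1} at which the block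
    -- has at least as many `+1`s as `-1`s
    (hbrk : ∀ t ∈ Finset.Icc 1 q,
      idx (t - 1) < idx t ∧ idx t ≤ m ∧
      cnt ε (-1) (idx (t - 1)) (idx t) ≤ cnt ε 1 (idx (t - 1)) (idx t) ∧
      (∀ i, idx (t - 1) < i → i < idx t →
        cnt ε 1 (idx (t - 1)) i < cnt ε (-1) (idx (t - 1)) i))
    -- the list i₁ < ⋯ < i_q contains all breakpoints: no further one exists
    (hlast : ∀ i, idx q < i → i ≤ m →
      cnt ε 1 (idx q) i < cnt ε (-1) (idx q) i) :
    (∀ t ∈ Finset.Icc 1 q,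
      (idx t = idx (t - 1) + 1 ∧ ε (idx t) = 1) ∨
      cnt ε 1 (idx (t - 1)) (idx t) = cnt ε (-1) (idx (t - 1)) (idx t)) ∧
    ((a : ℤ) - (b : ℤ) ≤ (q : ℤ)) := by
  have key : ∀ t ∈ Finset.Icc 1 q,
      (idx t = idx (t - 1) + 1 ∧ ε (idx t) = 1) ∨
      cnt ε 1 (idx (t - 1)) (idx t) = cnt ε (-1) (idx (t - 1)) (idx t) := by
    intro t ht
    obtain ⟨h1, h2, h3, h4⟩ := hbrk t ht
    generalize idx (t - 1) = s at *
    generalize idx t = e at *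
    obtain ⟨n, rfl⟩ : ∃ n, e = n + 1 := ⟨e - 1, by omega⟩
    have hp := cnt_succ ε 1 s n (by omega)
    have hm := cnt_succ ε (-1) s n (by omega)
    have he := hε (n + 1) (by simp; omega)
    rcases Nat.eq_or_lt_of_le (show s ≤ n by omega) with h | h
    · subst h
      left
      refine ⟨rfl, ?_⟩
      rcases he with he | he
      · exact he
      · rw [he] at hp hm
        simp [cnt_self] at hp hm
        omega
    · right
      have := h4 n h (by omega)
      rcases he with he | he <;> rw [he] at hp hm <;> simp at hp hm <;> omega
  refine ⟨key, ?_⟩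
  have main : ∀ t, t ≤ q → idx t ≤ m ∧
      cnt ε 1 0 (idx t) ≤ cnt ε (-1) 0 (idx t) + t := by
    intro t
    induction t with
    | zero => intro _; simp [hidx0, cnt_self]
    | succ t ih =>
      intro ht
      have ih := ih (by omega)
      have hm : t + 1 ∈ Finset.Icc 1 q := by simp; omega
      have k := key _ hm
      obtain ⟨h1, h2, -, -⟩ := hbrk _ hm
      simp only [Nat.add_sub_cancel] at k h1
      refine ⟨h2, ?_⟩
      rw [cnt_add ε 1 0 (idx t) (by omega) _ h1.le, cnt_add ε (-1) 0 (idx t) (by omega) _ h1.le]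
      rcases k with ⟨k1, k2⟩ | k
      · have := cnt_succ ε 1 (idx t) (idx t) le_rfl
        rw [← k1, k2, cnt_self] at this
        simp at this
        omega
      · omega
  obtain ⟨h1, h2⟩ := main q le_rfl
  have e1 : ∀ σ, ((Finset.Icc 1 m).filter (fun i => ε i = σ)).card = cnt ε σ 0 m := by
    intro σ; rfl
  rw [e1] at ha hb
  rw [cnt_add ε _ 0 (idx q) (by omega) m h1] at ha hb
  rcases Nat.eq_or_lt_of_le h1 with h | h
  · rw [h, cnt_self] at ha hb
    rw [h] at h2
    omega
  · have := hlast m h le_rfl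
    omega
end
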